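/- arXiv:1104.3007 — 7 statements merged into one kernel-verified Lean document; each statement's English description precedes it below -/
import Mathlib

section
/- Let M = (Q, Σ, q₀, δ, F) be a DFA. The almost-equivalence of states is a congruence on M: if q ∼ p for states q, p ∈ Q, then δ(q, σ) ∼ δ(p, σ) for every σ ∈ Σ. -/
/-- The right language of state `q`: all strings taking `M` from `q` into a final state. -/
def rightLang {α σ : Type*} (M : DFA α σ) (q : σ) : Set (List α) :=
  {w | M.evalFrom q w ∈ M.accept}

/-- States `q` and `p` of `M` are almost-equivalent if their right languages
are almost-equal, i.e. their symmetric difference is finite. -/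
def AlmostEq {α σ : Type*} (M : DFA α σ) (q p : σ) : Prop :=
  (symmDiff (rightLang M q) (rightLang M p)).Finite

theorem stmt2 {α σ : Type*} [Fintype α] [Fintype σ]
    (M : DFA α σ) (q p : σ) (h : AlmostEq M q p) :
    ∀ a : α, AlmostEq M (M.step q a) (M.step p a) := by
  intro a
  have h2 := Set.Finite.preimage (f := fun w : List α => a :: w)
    (fun x _ y _ hxy => (List.cons.inj hxy).2) h
  exact h2
end

section
/- Let M = (Q, Σ, q₀, δ, F) and N = (P, Σ, p₀, μ, G) be almost-equivalent DFAs over the same alphabet Σ. Then for every string w ∈ Σ*, the states δ̂(q₀, w) of M and μ̂(p₀, w) of N are almost-equivalent, i.e., L(δ̂(q₀, w), M) △ L(μ̂(p₀, w), N) is finite. -/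
/-- The language of `M`. -/
def lang {α σ : Type*} (M : DFA α σ) : Set (List α) :=
  rightLang M M.start

theorem stmt3 {α σ σ' : Type*} [Fintype α] [Fintype σ] [Fintype σ']
    (M : DFA α σ) (N : DFA α σ')
    (h : (symmDiff (lang M) (lang N)).Finite) :
    ∀ w : List α,
      (symmDiff (rightLang M (M.evalFrom M.start w))
        (rightLang N (N.evalFrom N.start w))).Finite := by
  intro w
  refine (h.preimage (f := fun v => w ++ v) (fun a _ b _ hab => List.append_cancel_left hab)).subset ?_
  intro v hv
  simpa [Set.mem_symmDiff, lang, rightLang, DFA.evalFrom_of_append] using hv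
end

section
/- Let M = (Q, Σ, q₀, δ, F) and N = (P, Σ, p₀, μ, G) be almost-equivalent hyper-minimal DFAs over the same alphabet Σ. Then there exists a mapping h : Q → P such that: (i) q ∼ h(q) for every q ∈ Q; (ii) h restricted to Pre(M) is a bijection from Pre(M) onto Pre(N), and for every q ∈ Pre(M) and σ ∈ Σ with δ(q, σ) ∈ Pre(M), μ(h(q), σ) = h(δ(q, σ)); (iii) h restricted to Ker(M) is a bijection from Ker(M) onto Ker(N), μ(h(q), σ) = h(δ(q, σ)) for every q ∈ Ker(M) and σ ∈ Σ, and for every q ∈ Ker(M), q ∈ F if and only if h(q) ∈ G. -/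
/-- The left language of state `q`: all strings taking `M` from its start state into `q`. -/
def leftLang {α σ : Type*} (M : DFA α σ) (q : σ) : Set (List α) :=
  {w | M.evalFrom M.start w = q}

/-- A kernel state: its left language is infinite. -/
def Kernel {α σ : Type*} (M : DFA α σ) (q : σ) : Prop :=
  (leftLang M q).Infinite

/-- A preamble state: its left language is finite. -/
def Preamble {α σ : Type*} (M : DFA α σ) (q : σ) : Prop :=
  (leftLang M q).Finite

/-- `M` is minimal: every state is reachable and distinct states have distinct
right languages. -/
def MinimalDFA {α σ : Type*} (M : DFA α σ) : Prop :=
  (∀ q, (leftLang M q).Nonempty) ∧ ∀ q p, rightLang M q = rightLang M p → q = p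

/-- `M` is hyper-minimal: it is minimal and has no pair of distinct almost-equivalent
states of which at least one is a preamble state. -/
def HyperMinimal {α σ : Type*} (M : DFA α σ) : Prop :=
  MinimalDFA M ∧ ¬ ∃ q p, q ≠ p ∧ (symmDiff (rightLang M q) (rightLang M p)).Finite ∧
    (Preamble M q ∨ Preamble M p)

/-- Almost-equal sets. -/
def AE4 {β : Type*} (A B : Set β) : Prop := (symmDiff A B).Finite

theorem AE4.symm {β : Type*} {A B : Set β} (h : AE4 A B) : AE4 B A := by
  unfold AE4 at *; rwa [symmDiff_comm]

theorem AE4.trans {β : Type*} {A B C : Set β} (h : AE4 A B) (h' : AE4 B C) : AE4 A C :=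
  (Set.Finite.union h h').subset (symmDiff_triangle A B C)

theorem AE4.of_eq {β : Type*} {A B : Set β} (h : A = B) : AE4 A B := by
  subst h; simp [AE4]

theorem ae4_eval {α σ σ' : Type*} {M : DFA α σ} {N : DFA α σ'} {q : σ} {p : σ'}
    (h : AE4 (rightLang M q) (rightLang N p)) (w : List α) :
    AE4 (rightLang M (M.evalFrom q w)) (rightLang N (N.evalFrom p w)) := by
  have := Set.Finite.preimage (f := fun u : List α => w ++ u)
    (fun a _ b _ hab => List.append_cancel_left hab) h
  refine this.subset ?_
  intro u hu
  simpa [Set.mem_symmDiff, rightLang, DFA.evalFrom_of_append] using hu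

theorem kernel4 {α σ σ' : Type*} [Finite σ'] {M : DFA α σ} {N : DFA α σ'}
    (h : AE4 (lang M) (lang N)) (q : σ) (hq : Kernel M q) :
    ∃ p, Kernel N p ∧ rightLang M q = rightLang N p := by
  have hfin : {w : List α | ∃ u, w ++ u ∈ symmDiff (lang M) (lang N)}.Finite := by
    refine (Set.Finite.biUnion h (t := fun d => {w | w ∈ d.inits})
      (fun d _ => List.finite_toSet _)).subset ?_
    rintro w ⟨u, hu⟩
    simp only [Set.mem_iUnion]
    exact ⟨w ++ u, hu, by simp⟩
  have hinf := Set.Infinite.diff hq hfin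
  obtain ⟨p, hp⟩ : ∃ p, ((leftLang M q \ {w : List α | ∃ u, w ++ u ∈ symmDiff (lang M) (lang N)})
      ∩ leftLang N p).Infinite := by
    by_contra hc
    push Not at hc
    refine hinf ((Set.finite_iUnion hc).subset ?_)
    intro w hw
    exact Set.mem_iUnion.2 ⟨N.evalFrom N.start w, hw, rfl⟩
  refine ⟨p, hp.mono Set.inter_subset_right, ?_⟩
  obtain ⟨w, ⟨hw1, hw2⟩, hw3⟩ := hp.nonempty
  ext u
  by_contra hc
  apply hw2
  refine ⟨u, ?_⟩
  simp only [leftLang, Set.mem_setOf_eq] at hw1 hw3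
  simp only [Set.mem_symmDiff, lang, rightLang, Set.mem_setOf_eq, DFA.evalFrom_of_append, hw1, hw3]
    at hc ⊢
  tauto

theorem preamble4 {α σ σ' : Type*} [Finite σ] {M : DFA α σ} {N : DFA α σ'}
    (h : AE4 (lang M) (lang N)) (hM : HyperMinimal M) (q : σ) (hq : Preamble M q) :
    ∃ p, Preamble N p ∧ AE4 (rightLang M q) (rightLang N p) := by
  obtain ⟨w, hw⟩ := hM.1.1 q
  have h1 := ae4_eval (M := M) (N := N) h w
  rw [show M.evalFrom M.start w = q from hw] at h1
  refine ⟨_, ?_, h1⟩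
  by_contra hk
  obtain ⟨q', hq', he⟩ := kernel4 h.symm _ hk
  refine hM.2 ⟨q, q', ?_, h1.trans (AE4.of_eq he), Or.inl hq⟩
  rintro rfl
  exact hq' hq

theorem hyp4 {α σ : Type*} {M : DFA α σ} (hM : HyperMinimal M) {q p : σ}
    (h : AE4 (rightLang M q) (rightLang M p)) (hq : Preamble M q) : q = p := by
  by_contra hc
  exact hM.2 ⟨q, p, hc, h, Or.inl hq⟩

theorem right4 {α σ σ' : Type*} {M : DFA α σ} {N : DFA α σ'} {q : σ} {p : σ'}
    (h : rightLang M q = rightLang N p) (a : α) :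
    rightLang M (M.step q a) = rightLang N (N.step p a) := by
  ext u
  have := Set.ext_iff.1 h (a :: u)
  simpa [rightLang] using this

theorem kstep4 {α σ : Type*} {M : DFA α σ} {q : σ} (h : Kernel M q) (a : α) :
    Kernel M (M.step q a) := by
  have : ((fun w : List α => w ++ [a]) '' leftLang M q).Infinite :=
    Set.Infinite.image (fun x _ y _ hxy => List.append_cancel_right hxy) h
  refine this.mono ?_
  rintro _ ⟨w, hw, rfl⟩
  simp only [leftLang, Set.mem_setOf_eq] at hw ⊢
  simp [DFA.evalFrom_of_append, hw]

theorem stmt4 {α σ σ' : Type*} [Fintype α] [Fintype σ] [Fintype σ']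
    (M : DFA α σ) (N : DFA α σ')
    (haeq : (symmDiff (lang M) (lang N)).Finite)
    (hM : HyperMinimal M) (hN : HyperMinimal N) :
    ∃ h : σ → σ',
      (∀ q, (symmDiff (rightLang M q) (rightLang N (h q))).Finite) ∧
      (Set.BijOn h {q | Preamble M q} {p | Preamble N p} ∧
        ∀ q, Preamble M q → ∀ a : α, Preamble M (M.step q a) →
          N.step (h q) a = h (M.step q a)) ∧
      (Set.BijOn h {q | Kernel M q} {p | Kernel N p} ∧
        (∀ q, Kernel M q → ∀ a : α, N.step (h q) a = h (M.step q a)) ∧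
        (∀ q, Kernel M q → (q ∈ M.accept ↔ h q ∈ N.accept))) := by
  have hae : AE4 (lang M) (lang N) := haeq
  have key : ∀ q, ∃ p, (Kernel M q → Kernel N p ∧ rightLang M q = rightLang N p) ∧
      (Preamble M q → Preamble N p ∧ AE4 (rightLang M q) (rightLang N p)) := by
    intro q
    by_cases hq : Preamble M q
    · obtain ⟨p, hp⟩ := preamble4 hae hM q hq
      exact ⟨p, fun hk => absurd hq hk, fun _ => hp⟩
    · obtain ⟨p, hp⟩ := kernel4 hae q hq
      exact ⟨p, fun _ => hp, fun h => absurd h hq⟩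
  choose h hk hp using key
  have hall : ∀ q, AE4 (rightLang M q) (rightLang N (h q)) := by
    intro q
    by_cases hq : Preamble M q
    · exact (hp q hq).2
    · exact AE4.of_eq (hk q hq).2
  refine ⟨h, hall, ⟨⟨fun q hq => (hp q hq).1, ?_, ?_⟩, ?_⟩, ⟨fun q hq => (hk q hq).1, ?_, ?_⟩, ?_, ?_⟩
  · intro q hq q' hq' e
    have := hall q
    rw [e] at this
    exact hyp4 hM (this.trans (hall q').symm) hq
  · intro p hpp
    obtain ⟨q, hq, hqp⟩ := preamble4 hae.symm hN p hpp
    exact ⟨q, hq, (hyp4 hN (hqp.trans (hall q)) hpp).symm⟩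
  · intro q hq a ha
    have h1 := ae4_eval (hall q) [a]
    simp only [DFA.evalFrom_singleton] at h1
    exact (hyp4 hN ((hall _).symm.trans h1) (hp _ ha).1).symm
  · intro q hq q' hq' e
    apply hM.1.2
    rw [(hk q hq).2, (hk q' hq').2, e]
  · intro p hpp
    obtain ⟨q, hq, hqp⟩ := kernel4 hae.symm p hpp
    exact ⟨q, hq, hN.1.2 _ _ (by rw [← (hk q hq).2, hqp])⟩
  · intro q hq a
    apply hN.1.2
    rw [← right4 (hk q hq).2 a, (hk _ (kstep4 hq a)).2]
  · intro q hq
    have := Set.ext_iff.1 (hk q hq).2 []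
    simpa [rightLang] using this
end

section
/- Let M = (Q, Σ, q₀, δ, F) be a DFA and let q, p ∈ Q be almost-equivalent states (q ∼ p). Then the (finite) cardinality of L(q, M) △ L(p, M) satisfies |L(q, M) △ L(p, M)| = Σ_{σ ∈ Σ} |L(δ(q, σ), M) △ L(δ(p, σ), M)| + c, where c = 1 if exactly one of q and p belongs to F, and c = 0 otherwise. -/
open scoped Classical

theorem ncard_lists_aux {α : Type*} [Fintype α] (S : Set (List α)) (h : S.Finite) :
    S.ncard = (∑ a : α, {w | a :: w ∈ S}.ncard) + (if [] ∈ S then 1 else 0) := by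
  rw [Set.ncard_eq_toFinset_card S h,
    Finset.card_eq_sum_card_fiberwise (f := List.head?) (t := Finset.univ)
      (fun x _ => Finset.mem_coe.2 (Finset.mem_univ _)), Fintype.sum_option, add_comm]
  congr 1
  · refine Finset.sum_congr rfl fun a _ => ?_
    rw [← Set.ncard_coe_finset,
      ← Set.ncard_image_of_injective {w | a :: w ∈ S} (List.cons_injective (a := a))]
    congr 1
    ext w
    cases w <;> simp <;> grind
  · split_ifs with h0
    · rw [Finset.card_eq_one]
      refine ⟨[], ?_⟩
      ext w
      cases w <;> simp [h0]
    · rw [Finset.card_eq_zero]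
      ext w
      cases w <;> simp [h0]

theorem stmt6 {α σ : Type*} [Fintype α] [Fintype σ] (M : DFA α σ) (q p : σ)
    (h : (symmDiff (rightLang M q) (rightLang M p)).Finite) :
    (symmDiff (rightLang M q) (rightLang M p)).ncard =
      (∑ a : α, (symmDiff (rightLang M (M.step q a)) (rightLang M (M.step p a))).ncard) +
        (if Xor' (q ∈ M.accept) (p ∈ M.accept) then 1 else 0) := by
  rw [ncard_lists_aux _ h]
  congr 1
end

section
/- Let M = (Q, Σ, q₀, δ, F) be a DFA and let q ∈ Q be a preamble state of M. Then the (finite) cardinality of the left language of q satisfies |L(M, q)| = c + Σ_{(p, σ) ∈ Q × Σ with δ(p, σ) = q} |L(M, p)|, where c = 1 if q = q₀ and c = 0 otherwise; moreover every state p occurring in this sum is a preamble state, so every summand is finite. -/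
open scoped Classical

theorem stmt8 {α σ : Type*} [Fintype α] [Fintype σ] (M : DFA α σ) (q : σ)
    (hq : Preamble M q) :
    (leftLang M q).ncard =
      (if q = M.start then 1 else 0) +
        ∑ x ∈ Finset.univ.filter (fun x : σ × α => M.step x.1 x.2 = q),
          (leftLang M x.1).ncard ∧
    ∀ p : σ, ∀ a : α, M.step p a = q → Preamble M p := by
  have hpre : ∀ p : σ, ∀ a : α, M.step p a = q → Preamble M p := by
    intro p a h
    refine Set.Finite.of_finite_image (f := fun w : List α => w ++ [a]) (hq.subset ?_) ?_
    · rintro _ ⟨w, hw, rfl⟩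
      simp only [leftLang, Set.mem_ofPred_eq] at hw ⊢
      rw [DFA.evalFrom_append_singleton, hw, h]
    · intro u _ v _ huv
      exact List.append_cancel_right huv
  refine ⟨?_, hpre⟩
  have hq' : (leftLang M q).Finite := hq
  set S := Finset.univ.filter (fun x : σ × α => M.step x.1 x.2 = q) with hS
  let G : σ × α → Finset (List α) := fun x =>
    hq'.toFinset.filter (fun w => ∃ u ∈ leftLang M x.1, w = u ++ [x.2])
  have hG : ∀ x ∈ S, ((G x).card = (leftLang M x.1).ncard) := by
    intro x hx
    have hx' : M.step x.1 x.2 = q := by simpa [hS] using hx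
    have hinj : Function.Injective (fun w : List α => w ++ [x.2]) := fun u v huv =>
      List.append_cancel_right huv
    rw [← Set.ncard_image_of_injective _ hinj, ← Set.ncard_coe_finset]
    congr 1
    ext w
    simp only [G, Finset.coe_filter, Set.Finite.mem_toFinset, Set.mem_ofPred_eq, Set.mem_image]
    constructor
    · rintro ⟨_, u, hu, rfl⟩
      exact ⟨u, hu, rfl⟩
    · rintro ⟨u, hu, rfl⟩
      refine ⟨?_, u, hu, rfl⟩
      simp only [leftLang, Set.mem_ofPred_eq] at hu ⊢
      rw [DFA.evalFrom_append_singleton, hu, hx']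
  rw [← Finset.sum_congr rfl hG, ← Finset.card_biUnion]
  · have h0 : (if q = M.start then 1 else 0) =
        (if q = M.start then ({[]} : Finset (List α)) else ∅).card := by
      split_ifs <;> simp
    rw [h0, ← Finset.card_union_of_disjoint, ← Set.ncard_coe_finset]
    · congr 1
      ext w
      rcases List.eq_nil_or_concat w with rfl | ⟨u, a, rfl⟩
      · by_cases h : q = M.start
        · simp [h, leftLang]
        · have hn : ([] : List α) ∉ leftLang M q := fun hh => h (Eq.symm hh)
          simp [h, hn, G]
      · rw [List.concat_eq_append]
        have e : (u ++ [a] ∈ leftLang M q) ↔ M.step (M.evalFrom M.start u) a = q := by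
          simp only [leftLang, Set.mem_ofPred_eq]
          rw [DFA.evalFrom_append_singleton]
        have e1 : u ++ [a] ∉ (if q = M.start then ({[]} : Finset (List α)) else ∅) := by
          split_ifs <;> simp
        rw [Finset.mem_coe, Finset.mem_union, or_iff_right e1, Finset.mem_biUnion]
        constructor
        · intro h
          refine ⟨(M.evalFrom M.start u, a), by simpa [hS] using e.1 h, ?_⟩
          simp only [G, Finset.mem_filter, Set.Finite.mem_toFinset]
          exact ⟨h, u, rfl, rfl⟩
        · rintro ⟨x, _, hx⟩
          simp only [G, Finset.mem_filter, Set.Finite.mem_toFinset] at hx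
          exact hx.1
    · rw [Finset.disjoint_left]
      intro w hw hw'
      have : w = [] := by
        split_ifs at hw
        · simpa using hw
        · simp at hw
      subst this
      simp [G] at hw'
  · intro x _ y _ hxy
    change Disjoint (G x) (G y)
    rw [Finset.disjoint_left]
    intro w hw hw'
    simp only [G, Finset.mem_filter] at hw hw'
    obtain ⟨_, u, hu, rfl⟩ := hw
    obtain ⟨_, v, hv, h⟩ := hw'
    obtain ⟨h1, h2⟩ := List.append_inj' h rfl
    subst h1
    apply hxy
    refine Prod.ext (hu.symm.trans hv) (by simpa using h2)
end

section
/- Let M = (Q, Σ, q₀, δ, F) be a minimal DFA. Then the collection consisting of W_0, the sets W_B for B ∈ P_∼, and the sets W_{B,σ} for B ∈ P_∼ and σ ∈ Σ with ⋃_{q ∈ B} K_{δ(q, σ)} ≠ ∅, is a weak partition of Σ*: these sets are pairwise disjoint and their union is Σ*. -/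
open scoped Classical

/-- `K_q`: the set of kernel states almost-equivalent to `q`. -/
def Kq {α σ : Type*} (M : DFA α σ) (q : σ) : Set σ :=
  {p | Kernel M p ∧ AlmostEq M p q}

/-- `P_∼`: the set of equivalence classes of the almost-equivalence consisting
exclusively of preamble states. -/
def Psim {α σ : Type*} (M : DFA α σ) : Set (Set σ) :=
  {B | (∃ q, B = {p | AlmostEq M q p}) ∧ ∀ p ∈ B, Preamble M p}

/-- `W_0`: all strings if some kernel state is almost-equivalent to the initial state,
and the empty set otherwise. -/
def W0 {α σ : Type*} (M : DFA α σ) : Set (List α) :=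
  if (Kq M M.start).Nonempty then Set.univ else ∅

/-- `W_B`: the union of the left languages of the states of `B`. -/
def WB {α σ : Type*} (M : DFA α σ) (B : Set σ) : Set (List α) :=
  ⋃ q ∈ B, leftLang M q

/-- `W_{B,σ}`: the strings `uσw` with `u ∈ W_B`. -/
def WBs {α σ : Type*} (M : DFA α σ) (B : Set σ) (a : α) : Set (List α) :=
  {w | ∃ u v, u ∈ WB M B ∧ w = u ++ a :: v}

section helpers
variable {α σ : Type*} {M : DFA α σ}

theorem ae_refl (q : σ) : AlmostEq M q q := by simp [AlmostEq]

theorem ae_symm {q p : σ} (h : AlmostEq M q p) : AlmostEq M p q := by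
  unfold AlmostEq at *; rwa [symmDiff_comm]

theorem ae_trans {q p r : σ} (h : AlmostEq M q p) (h' : AlmostEq M p r) : AlmostEq M q r :=
  (h.union h').subset (symmDiff_triangle _ _ _)

theorem ae_step {q p : σ} (h : AlmostEq M q p) (a : α) :
    AlmostEq M (M.step q a) (M.step p a) := by
  have := Set.Finite.preimage (f := fun w : List α => a :: w)
    (fun x _ y _ h => by simpa using h) h
  refine this.subset ?_
  intro w hw
  simpa [Set.mem_symmDiff, rightLang] using hw

theorem kernel_step {q : σ} (h : Kernel M q) (a : α) : Kernel M (M.step q a) := by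
  have := Set.Infinite.image (f := fun w : List α => w ++ [a])
    (fun x _ y _ h => by simpa using h) h
  refine this.mono ?_
  rintro _ ⟨w, hw, rfl⟩
  simp only [leftLang, Set.mem_setOf_eq] at hw ⊢
  rw [DFA.evalFrom_append_singleton, hw]

def GG (M : DFA α σ) (w : List α) : Prop := (Kq M (M.evalFrom M.start w)).Nonempty

theorem gg_step {w : List α} (h : GG M w) (a : α) : GG M (w ++ [a]) := by
  obtain ⟨p, hp, hq⟩ := h
  refine ⟨M.step p a, kernel_step hp a, ?_⟩
  rw [DFA.evalFrom_append_singleton]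
  exact ae_step hq a

theorem gg_append {w : List α} (h : GG M w) (v : List α) : GG M (w ++ v) := by
  induction v generalizing w with
  | nil => simpa using h
  | cons a v ih =>
    have := ih (gg_step h a)
    simpa using this

theorem mem_WB {B : Set σ} {w : List α} : w ∈ WB M B ↔ M.evalFrom M.start w ∈ B := by
  simp [WB, leftLang]

theorem not_gg {B : Set σ} (hB : B ∈ Psim M) {w : List α} (h : w ∈ WB M B) : ¬ GG M w := by
  obtain ⟨⟨q, rfl⟩, hP⟩ := hB
  rintro ⟨p, hp, hpw⟩
  exact hp (hP p (ae_trans (mem_WB.1 h) (ae_symm hpw)))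

theorem exists_B {w : List α} (h : ¬ GG M w) : ∃ B ∈ Psim M, w ∈ WB M B := by
  refine ⟨{p | AlmostEq M (M.evalFrom M.start w) p}, ⟨⟨_, rfl⟩, ?_⟩, mem_WB.2 (ae_refl _)⟩
  intro p hp
  by_contra hc
  exact h ⟨p, hc, ae_symm hp⟩

theorem B_eq {B₁ B₂ : Set σ} (h₁ : B₁ ∈ Psim M) (h₂ : B₂ ∈ Psim M) {w : List α}
    (hw₁ : w ∈ WB M B₁) (hw₂ : w ∈ WB M B₂) : B₁ = B₂ := by
  obtain ⟨⟨q, rfl⟩, -⟩ := h₁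
  obtain ⟨⟨p, rfl⟩, -⟩ := h₂
  have a := mem_WB.1 hw₁
  have b := mem_WB.1 hw₂
  have c : AlmostEq M q p := ae_trans a (ae_symm b)
  ext r
  exact ⟨fun h => ae_trans (ae_symm c) h, fun h => ae_trans c h⟩

theorem gg_WBs {B : Set σ} (hB : B ∈ Psim M) {a : α}
    (hn : (⋃ q ∈ B, Kq M (M.step q a)).Nonempty) {u : List α} (h : u ∈ WB M B) :
    GG M (u ++ [a]) := by
  obtain ⟨⟨q, rfl⟩, -⟩ := hB
  obtain ⟨p, hp⟩ := hn
  simp only [Set.mem_iUnion] at hp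
  obtain ⟨r, hr, hk, hpr⟩ := hp
  refine ⟨p, hk, ae_trans hpr ?_⟩
  rw [DFA.evalFrom_append_singleton]
  exact ae_step (ae_trans (ae_symm hr) (mem_WB.1 h)) a

theorem uniq_aux {u₁ u₂ v₁ v₂ : List α} {a₁ a₂ : α} (h₂ : ¬ GG M u₂)
    (g₁ : GG M (u₁ ++ [a₁])) {c : List α} (hc : u₂ = u₁ ++ c)
    (hv : a₁ :: v₁ = c ++ a₂ :: v₂) : u₁ = u₂ ∧ a₁ = a₂ := by
  cases c with
  | nil => simp at hc hv; exact ⟨hc.symm, hv.1⟩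
  | cons x c =>
    simp at hv
    obtain ⟨rfl, -⟩ := hv
    refine absurd ?_ h₂
    have := gg_append g₁ c
    rw [hc]; simpa using this

theorem uniq {u₁ u₂ v₁ v₂ : List α} {a₁ a₂ : α} (h₁ : ¬ GG M u₁) (h₂ : ¬ GG M u₂)
    (g₁ : GG M (u₁ ++ [a₁])) (g₂ : GG M (u₂ ++ [a₂]))
    (h : u₁ ++ a₁ :: v₁ = u₂ ++ a₂ :: v₂) : u₁ = u₂ ∧ a₁ = a₂ := by
  rcases List.append_eq_append_iff.1 h with ⟨c, hc, hv⟩ | ⟨c, hc, hv⟩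
  · exact uniq_aux h₂ g₁ hc hv
  · have := uniq_aux h₁ g₂ hc hv
    exact ⟨this.1.symm, this.2.symm⟩

theorem exists_split (h0 : ¬ GG M []) (w : List α) (hw : GG M w) :
    ∃ u a v, w = u ++ a :: v ∧ ¬ GG M u ∧ GG M (u ++ [a]) := by
  induction w using List.reverseRecOn with
  | nil => exact absurd hw h0
  | append_singleton w a ih =>
    by_cases h : GG M w
    · obtain ⟨u, b, v, rfl, h1, h2⟩ := ih h
      exact ⟨u, b, v ++ [a], by simp, h1, h2⟩
    · exact ⟨w, a, [], rfl, h, hw⟩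

theorem mem_W0 {w : List α} : w ∈ W0 M ↔ GG M [] := by
  unfold W0 GG
  split_ifs with h <;> simpa using h

end helpers

theorem stmt9 {α σ : Type*} [Fintype α] [Fintype σ] (M : DFA α σ)
    (hM : MinimalDFA M) :
    (∀ B ∈ Psim M, Disjoint (W0 M) (WB M B)) ∧
    (∀ B ∈ Psim M, ∀ a : α, (⋃ q ∈ B, Kq M (M.step q a)).Nonempty →
      Disjoint (W0 M) (WBs M B a)) ∧
    (∀ B₁ ∈ Psim M, ∀ B₂ ∈ Psim M, B₁ ≠ B₂ → Disjoint (WB M B₁) (WB M B₂)) ∧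
    (∀ B₁ ∈ Psim M, ∀ B₂ ∈ Psim M, ∀ a : α,
      (⋃ q ∈ B₂, Kq M (M.step q a)).Nonempty → Disjoint (WB M B₁) (WBs M B₂ a)) ∧
    (∀ B₁ ∈ Psim M, ∀ B₂ ∈ Psim M, ∀ a₁ a₂ : α,
      (⋃ q ∈ B₁, Kq M (M.step q a₁)).Nonempty →
      (⋃ q ∈ B₂, Kq M (M.step q a₂)).Nonempty →
      (B₁, a₁) ≠ (B₂, a₂) → Disjoint (WBs M B₁ a₁) (WBs M B₂ a₂)) ∧
    (W0 M ∪ (⋃ B ∈ Psim M, WB M B) ∪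
      (⋃ B ∈ Psim M, ⋃ a : α,
        ⋃ (_ : (⋃ q ∈ B, Kq M (M.step q a)).Nonempty), WBs M B a) = Set.univ) := by
  refine ⟨?_, ?_, ?_, ?_, ?_, ?_⟩
  · intro B hB
    rw [Set.disjoint_left]
    intro w h0 hw
    exact not_gg hB hw (gg_append (mem_W0.1 h0) w)
  · intro B hB a _
    rw [Set.disjoint_left]
    rintro w h0 ⟨u, v, hu, -⟩
    exact not_gg hB hu (gg_append (mem_W0.1 h0) u)
  · intro B₁ h₁ B₂ h₂ hne
    rw [Set.disjoint_left]
    intro w hw₁ hw₂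
    exact hne (B_eq h₁ h₂ hw₁ hw₂)
  · intro B₁ h₁ B₂ h₂ a hn
    rw [Set.disjoint_left]
    rintro w hw ⟨u, v, hu, rfl⟩
    have := gg_append (gg_WBs h₂ hn hu) v
    exact not_gg h₁ hw (by simpa using this)
  · intro B₁ h₁ B₂ h₂ a₁ a₂ hn₁ hn₂ hne
    rw [Set.disjoint_left]
    rintro w ⟨u₁, v₁, hu₁, rfl⟩ ⟨u₂, v₂, hu₂, he⟩
    obtain ⟨rfl, rfl⟩ := uniq (not_gg h₁ hu₁) (not_gg h₂ hu₂) (gg_WBs h₁ hn₁ hu₁)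
      (gg_WBs h₂ hn₂ hu₂) he
    exact hne (by rw [B_eq h₁ h₂ hu₁ hu₂])
  · rw [Set.eq_univ_iff_forall]
    intro w
    by_cases h0 : GG M []
    · exact Or.inl (Or.inl (mem_W0.2 h0))
    by_cases hw : GG M w
    · right
      obtain ⟨u, a, v, rfl, h1, p, hp⟩ := exists_split h0 w hw
      obtain ⟨B, hB, hu⟩ := exists_B h1
      rw [DFA.evalFrom_append_singleton] at hp
      simp only [Set.mem_iUnion]
      refine ⟨B, hB, a, ⟨p, ?_⟩, u, v, hu, rfl⟩
      simp only [Set.mem_iUnion]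
      exact ⟨_, mem_WB.1 hu, hp⟩
    · left; right
      obtain ⟨B, hB, hu⟩ := exists_B hw
      simp only [Set.mem_iUnion]
      exact ⟨B, hB, hu⟩
end

section
/- Let M = (Q, Σ, q₀, δ, F) be a minimal DFA. If some kernel state of M is almost-equivalent to the initial state q₀, then every preamble state of M is almost-equivalent to some kernel state of M. -/
theorem stmt10 {α σ : Type*} [Fintype α] [Fintype σ] (M : DFA α σ)
    (hM : MinimalDFA M) (h : ∃ k, Kernel M k ∧ AlmostEq M k M.start) :
    ∀ p, Preamble M p → ∃ k, Kernel M k ∧ AlmostEq M p k := by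
  obtain ⟨k, hk, hkq⟩ := h
  intro p _
  obtain ⟨w, hw⟩ := hM.1 p
  have hw' : M.evalFrom M.start w = p := hw
  refine ⟨M.evalFrom k w, ?_, ?_⟩
  · have hinj : Function.Injective (fun u : List α => u ++ w) :=
      fun a b hab => List.append_cancel_right hab
    refine Set.Infinite.mono ?_ (Set.Infinite.image hinj.injOn hk)
    rintro _ ⟨u, hu, rfl⟩
    have hu' : M.evalFrom M.start u = k := hu
    change M.evalFrom M.start (u ++ w) = M.evalFrom k w
    rw [DFA.evalFrom_of_append, hu']
  · have hinj : Function.Injective (fun u : List α => w ++ u) :=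
      fun a b hab => List.append_cancel_left hab
    refine Set.Finite.subset (Set.Finite.preimage hinj.injOn hkq) ?_
    intro u hu
    simp only [rightLang, Set.mem_symmDiff, Set.mem_preimage, Set.mem_setOf_eq,
      DFA.evalFrom_of_append, hw'] at hu ⊢
    exact hu.symm
end
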